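/- Assume the principal submatrices L(σ⁻)[Ω⁻,Ω⁻] and L(σ⁺)[Ω⁺,Ω⁺] are invertible. Then the Dirichlet-to-Neumann maps Λ± = (∓I/2 + D')S⁻¹ coincide with the (negated) Schur complements: Λ± = ∓( L(σ±)[∂Ω,∂Ω] − L(σ±)[∂Ω,Ω±] (L(σ±)[Ω±,Ω±])⁻¹ L(σ±)[Ω±,∂Ω] ). -/

import Mathlib

open Matrix BigOperators

noncomputable section

variable {V : Type*} [Fintype V] [DecidableEq V]

/-- Weighted graph Laplacian of a symmetric weight function. -/
def lap (σ : V → V → ℝ) : Matrix V V ℝ :=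
  Matrix.of fun x y => if x = y then ∑ z, σ x z else -σ x y

/-- Restriction matrix `R_X : ℝ^V → ℝ^X`. -/
def restr (X : Finset V) : Matrix {x // x ∈ X} V ℝ :=
  Matrix.of fun i j => if (i : V) = j then 1 else 0

/-- Green function `G = R_{V°}ᵀ (L[V°,V°])⁻¹ R_{V°}` with `V° = Bᶜ`. -/
def green (B : Finset V) (σ : V → V → ℝ) : Matrix V V ℝ :=
  (restr Bᶜ)ᵀ * (restr Bᶜ * lap σ * (restr Bᶜ)ᵀ)⁻¹ * restr Bᶜ

/-- Dirichlet trace operator `γ₀ = R_{∂Ω}`. -/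
def gamma0 (dO : Finset V) : Matrix {x // x ∈ dO} V ℝ := restr dO

/-- Exterior Neumann trace operator `γ₁⁺ = -R_{∂Ω} L(σ⁺)`. -/
def gamma1p (dO : Finset V) (σp : V → V → ℝ) : Matrix {x // x ∈ dO} V ℝ :=
  -(restr dO * lap σp)

/-- Interior Neumann trace operator `γ₁⁻ = R_{∂Ω} L(σ⁻)`. -/
def gamma1m (dO : Finset V) (σm : V → V → ℝ) : Matrix {x // x ∈ dO} V ℝ :=
  restr dO * lap σm

/-- Single layer potential `𝒮 = G γ₀ᵀ`. -/
def slp (B dO : Finset V) (σ : V → V → ℝ) : Matrix V {x // x ∈ dO} ℝ :=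
  green B σ * (gamma0 dO)ᵀ

/-- Exterior double layer potential `𝒟⁺ = G (γ₁⁺)ᵀ`. -/
def dlpP (B dO : Finset V) (σ σp : V → V → ℝ) : Matrix V {x // x ∈ dO} ℝ :=
  green B σ * (gamma1p dO σp)ᵀ

/-- Interior double layer potential `𝒟⁻ = G (γ₁⁻)ᵀ`. -/
def dlpM (B dO : Finset V) (σ σm : V → V → ℝ) : Matrix V {x // x ∈ dO} ℝ :=
  green B σ * (gamma1m dO σm)ᵀ

/-- Single layer boundary operator `S = γ₀ 𝒮`. -/
def Sop (B dO : Finset V) (σ : V → V → ℝ) : Matrix {x // x ∈ dO} {x // x ∈ dO} ℝ :=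
  gamma0 dO * slp B dO σ

/-- Double layer boundary operator `D = ½ γ₀ (𝒟⁺ + 𝒟⁻)`. -/
def Dop (B dO : Finset V) (σ σp σm : V → V → ℝ) : Matrix {x // x ∈ dO} {x // x ∈ dO} ℝ :=
  (1/2 : ℝ) • (gamma0 dO * (dlpP B dO σ σp + dlpM B dO σ σm))

/-- Adjoint double layer (Neumann–Poincaré) operator `D' = ½ (γ₁⁺ + γ₁⁻) 𝒮`. -/
def Dadj (B dO : Finset V) (σ σp σm : V → V → ℝ) : Matrix {x // x ∈ dO} {x // x ∈ dO} ℝ :=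
  (1/2 : ℝ) • ((gamma1p dO σp + gamma1m dO σm) * slp B dO σ)

/-- Hypersingular operator `H = -γ₁⁺ 𝒟⁻`. -/
def Hop (B dO : Finset V) (σ σp σm : V → V → ℝ) : Matrix {x // x ∈ dO} {x // x ∈ dO} ℝ :=
  -(gamma1p dO σp * dlpM B dO σ σm)

/-- Indicator vector of a node subset. -/
def ind (X : Finset V) : V → ℝ := fun x => if x ∈ X then 1 else 0

/-- The subgraph with node set `A` and edges `{x,y}` with `w x y > 0` is connected. -/
def connOn (A : Finset V) (w : V → V → ℝ) : Prop :=
  ∀ x ∈ A, ∀ y ∈ A, Relation.ReflTransGen (fun a b => a ∈ A ∧ b ∈ A ∧ 0 < w a b) x y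

theorem lap_add (σ τ : V → V → ℝ) : lap (fun x y => σ x y + τ x y) = lap σ + lap τ := by
  ext x y
  by_cases h : x = y
  · simp [lap, h, Finset.sum_add_distrib]
  · simp [lap, h]
    ring

theorem lap_transpose {σ : V → V → ℝ} (hσ : ∀ x y, σ x y = σ y x) : (lap σ)ᵀ = lap σ := by
  ext x y
  by_cases h : x = y
  · simp [lap, h]
  · simp [lap, h, Ne.symm h, hσ y x]

theorem restr_mul_apply {n : Type*} (X : Finset V) (M : Matrix V n ℝ) (i : {x // x ∈ X}) (j : n) :
    (restr X * M) i j = M i j := by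
  simp [restr, Matrix.mul_apply]

theorem restr_mul_lap_eq_zero {X : Finset V} {σ : V → V → ℝ} (h : ∀ x ∈ X, ∀ y, σ x y = 0) :
    restr X * lap σ = 0 := by
  ext i j
  simp [restr_mul_apply, lap, h i i.2]

theorem lap_mul_restr_transpose_eq_zero {X : Finset V} {σ : V → V → ℝ}
    (hσ : ∀ x y, σ x y = σ y x) (h : ∀ x ∈ X, ∀ y, σ x y = 0) :
    lap σ * (restr X)ᵀ = 0 := by
  rw [← lap_transpose hσ, ← Matrix.transpose_mul, restr_mul_lap_eq_zero h, Matrix.transpose_zero]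

theorem restr_mul_restr_transpose (X : Finset V) : restr X * (restr X)ᵀ = 1 := by
  ext i j
  rw [restr_mul_apply]
  simp [restr, Matrix.one_apply, eq_comm]

theorem restr_mul_restr_transpose_of_disjoint {X Y : Finset V} (h : Disjoint X Y) :
    restr X * (restr Y)ᵀ = 0 := by
  ext i j
  have : (j : V) ≠ i := fun e => Finset.disjoint_left.mp h i.2 (e ▸ j.2)
  rw [restr_mul_apply]
  simp [restr, this]

theorem restr_transpose_mul_restr (X : Finset V) :
    (restr X)ᵀ * restr X = Matrix.diagonal (ind X) := by
  ext x y
  rw [Matrix.mul_apply]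
  change ∑ z : {x // x ∈ X}, (if (z : V) = x then (1 : ℝ) else 0) * (if (z : V) = y then 1 else 0)
    = _
  rw [Finset.sum_coe_sort X fun z =>
    (if z = x then (1 : ℝ) else 0) * (if z = y then 1 else 0)]
  by_cases h : x = y
  · subst h
    simp [ind]
  · simp [h, Ne.symm h]

theorem restr_mul_restr_compl_restr {X Y : Finset V} (h : Disjoint Y X) :
    restr X * ((restr Yᶜ)ᵀ * restr Yᶜ) = restr X := by
  ext i j
  rw [restr_mul_apply, restr_transpose_mul_restr, Matrix.diagonal_apply]
  have : (i : V) ∉ Y := fun hi => Finset.disjoint_left.mp h hi i.2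
  simp [ind, restr, this]

theorem sum_restr_transpose_mul_restr {B X d Y : Finset V}
    (hBX : Disjoint B X) (hBd : Disjoint B d) (hBY : Disjoint B Y)
    (hXd : Disjoint X d) (hXY : Disjoint X Y) (hdY : Disjoint d Y)
    (hcover : B ∪ X ∪ d ∪ Y = Finset.univ) :
    (restr B)ᵀ * restr B + (restr X)ᵀ * restr X + (restr d)ᵀ * restr d
      + (restr Y)ᵀ * restr Y = 1 := by
  simp only [restr_transpose_mul_restr, Matrix.diagonal_add]
  rw [← Matrix.diagonal_one]
  congr 1
  funext x
  have hx : x ∈ B ∪ X ∪ d ∪ Y := hcover ▸ Finset.mem_univ x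
  simp only [Finset.mem_union] at hx
  rw [Finset.disjoint_left] at *
  simp only [ind]
  grind

section Potential

variable {B d X : Finset V} {σ : V → V → ℝ}

theorem restr_mul_slp_eq_zero : restr B * slp B d σ = 0 := by
  have h : restr B * (restr Bᶜ)ᵀ = 0 :=
    restr_mul_restr_transpose_of_disjoint disjoint_compl_right
  simp only [slp, green, ← Matrix.mul_assoc, h, Matrix.zero_mul]

theorem restr_compl_mul_lap_mul_slp
    (hA : IsUnit (restr Bᶜ * lap σ * (restr Bᶜ)ᵀ).det) :
    restr Bᶜ * (lap σ * slp B d σ) = restr Bᶜ * (restr d)ᵀ := by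
  simp only [slp, green, gamma0, ← Matrix.mul_assoc]
  rw [Matrix.mul_nonsing_inv _ hA, Matrix.one_mul]

theorem restr_mul_lap_mul_slp (hX : Disjoint B X)
    (hA : IsUnit (restr Bᶜ * lap σ * (restr Bᶜ)ᵀ).det) :
    restr X * (lap σ * slp B d σ) = restr X * (restr d)ᵀ := by
  rw [← restr_mul_restr_compl_restr hX, Matrix.mul_assoc, Matrix.mul_assoc,
    restr_compl_mul_lap_mul_slp hA]
  simp only [Matrix.mul_assoc]

theorem isUnit_det_Sop (hd : Disjoint B d)
    (hA : (restr Bᶜ * lap σ * (restr Bᶜ)ᵀ).PosDef) : IsUnit (Sop B d σ).det := by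
  set K : Matrix {x // x ∈ Bᶜ} {x // x ∈ d} ℝ := restr Bᶜ * (restr d)ᵀ with hK
  have hKK : Kᴴ * K = 1 := by
    rw [hK, Matrix.conjTranspose_eq_transpose_of_trivial, Matrix.transpose_mul,
      Matrix.transpose_transpose, Matrix.mul_assoc, ← Matrix.mul_assoc (restr Bᶜ)ᵀ,
      ← Matrix.mul_assoc (restr d), restr_mul_restr_compl_restr hd, restr_mul_restr_transpose]
  have hinj : Function.Injective K.mulVec := by
    intro u v huv
    have := congrArg Kᴴ.mulVec huv
    simpa only [Matrix.mulVec_mulVec, hKK, Matrix.one_mulVec] using this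
  have hS : Sop B d σ = Kᴴ * (restr Bᶜ * lap σ * (restr Bᶜ)ᵀ)⁻¹ * K := by
    simp only [Sop, slp, green, gamma0, hK, Matrix.conjTranspose_eq_transpose_of_trivial,
      Matrix.transpose_mul, Matrix.transpose_transpose, Matrix.mul_assoc]
  rw [hS]
  exact (hA.inv.conjTranspose_mul_mul_same hinj).det_pos.ne'.isUnit

end Potential

/-- If `M W` only sees the values of `W` on `X` and `d`, and vanishes on `X`, then eliminating the
values on `X` leaves the Schur complement of `M[X, X]` acting on the values on `d`. -/
theorem restr_mul_eq_schur_mul {n : Type*} {X d : Finset V} {M : Matrix V V ℝ} {W : Matrix V n ℝ}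
    (hX : IsUnit (restr X * M * (restr X)ᵀ).det) (hzero : restr X * (M * W) = 0)
    (hsupp : M * W = M * (restr X)ᵀ * (restr X * W) + M * (restr d)ᵀ * (restr d * W)) :
    restr d * (M * W)
      = (restr d * M * (restr d)ᵀ
          - restr d * M * (restr X)ᵀ * (restr X * M * (restr X)ᵀ)⁻¹
            * (restr X * M * (restr d)ᵀ)) * (restr d * W) := by
  have key : restr X * W
      = -((restr X * M * (restr X)ᵀ)⁻¹ * (restr X * M * (restr d)ᵀ * (restr d * W))) := by
    rw [hsupp, Matrix.mul_add] at hzero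
    simp only [← Matrix.mul_assoc] at hzero
    have h := congrArg ((restr X * M * (restr X)ᵀ)⁻¹ * ·) (eq_neg_of_add_eq_zero_left hzero)
    simp only [Matrix.mul_assoc _ (restr X) W] at h
    rw [Matrix.nonsing_inv_mul_cancel_left _ _ hX] at h
    rw [h, Matrix.mul_neg]
    simp only [Matrix.mul_assoc]
  rw [hsupp, key, Matrix.mul_add, Matrix.sub_mul]
  simp only [Matrix.mul_assoc, Matrix.mul_neg]
  abel

theorem lap_mul_eq_of_vanish {n : Type*} {B X d Y : Finset V} {τ : V → V → ℝ} {W : Matrix V n ℝ}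
    (hpart : (restr B)ᵀ * restr B + (restr X)ᵀ * restr X + (restr d)ᵀ * restr d
      + (restr Y)ᵀ * restr Y = 1)
    (hB : restr B * W = 0) (hY : lap τ * (restr Y)ᵀ = 0) :
    lap τ * W
      = lap τ * (restr X)ᵀ * (restr X * W) + lap τ * (restr d)ᵀ * (restr d * W) := by
  calc lap τ * W = lap τ * ((restr B)ᵀ * restr B + (restr X)ᵀ * restr X + (restr d)ᵀ * restr d
      + (restr Y)ᵀ * restr Y) * W := by rw [hpart, Matrix.mul_one]
    _ = lap τ * (restr B)ᵀ * (restr B * W) + lap τ * (restr X)ᵀ * (restr X * W)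
        + lap τ * (restr d)ᵀ * (restr d * W) + lap τ * (restr Y)ᵀ * (restr Y * W) := by
      simp only [Matrix.mul_add, Matrix.add_mul, Matrix.mul_assoc]
    _ = _ := by rw [hB, hY]; simp

theorem stmt_14
    {V : Type*} [Fintype V] [DecidableEq V]
    (B Op dO Om : Finset V)
    (hBne : B.Nonempty) (hOpne : Op.Nonempty) (hdOne : dO.Nonempty) (hOmne : Om.Nonempty)
    (hd1 : Disjoint B Op) (hd2 : Disjoint B dO) (hd3 : Disjoint B Om)
    (hd4 : Disjoint Op dO) (hd5 : Disjoint Op Om) (hd6 : Disjoint dO Om)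
    (hcover : B ∪ Op ∪ dO ∪ Om = Finset.univ)
    (σ σp σm : V → V → ℝ)
    (hσsymm : ∀ x y, σ x y = σ y x) (hσdiag : ∀ x, σ x x = 0)
    (hσnn : ∀ x y, 0 ≤ σ x y)
    (hsepBdO : ∀ x ∈ B, ∀ y ∈ dO, σ x y = 0)
    (hsepBOm : ∀ x ∈ B, ∀ y ∈ Om, σ x y = 0)
    (hsepOpOm : ∀ x ∈ Op, ∀ y ∈ Om, σ x y = 0)
    (hσpsymm : ∀ x y, σp x y = σp y x) (hσpdiag : ∀ x, σp x x = 0)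
    (hσmsymm : ∀ x y, σm x y = σm y x) (hσmdiag : ∀ x, σm x x = 0)
    (hσpnn : ∀ x y, 0 ≤ σp x y) (hσmnn : ∀ x y, 0 ≤ σm x y)
    (hsum : ∀ x y, σp x y + σm x y = σ x y)
    (hp1 : ∀ x y, x ∈ B ∪ Op ∨ y ∈ B ∪ Op → σp x y = σ x y)
    (hm1 : ∀ x y, x ∈ Om ∨ y ∈ Om → σm x y = σ x y)
    (hpd : (restr Bᶜ * lap σ * (restr Bᶜ)ᵀ).PosDef)
    (hOmInv : IsUnit (restr Om * lap σm * (restr Om)ᵀ).det)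
    (hOpInv : IsUnit (restr Op * lap σp * (restr Op)ᵀ).det) :
    ((-(1/2) : ℝ) • 1 + Dadj B dO σ σp σm) * (Sop B dO σ)⁻¹
      = -(restr dO * lap σp * (restr dO)ᵀ
          - restr dO * lap σp * (restr Op)ᵀ * (restr Op * lap σp * (restr Op)ᵀ)⁻¹
            * (restr Op * lap σp * (restr dO)ᵀ))
    ∧ (((1/2) : ℝ) • 1 + Dadj B dO σ σp σm) * (Sop B dO σ)⁻¹
      = restr dO * lap σm * (restr dO)ᵀ
          - restr dO * lap σm * (restr Om)ᵀ * (restr Om * lap σm * (restr Om)ᵀ)⁻¹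
            * (restr Om * lap σm * (restr dO)ᵀ) := by
  have hA : IsUnit (restr Bᶜ * lap σ * (restr Bᶜ)ᵀ).det := hpd.det_pos.ne'.isUnit
  have hS := isUnit_det_Sop hd2 hpd
  have hlap : lap σ = lap σp + lap σm := by
    rw [← lap_add]
    simp only [hsum]
  have hm0 : ∀ x ∈ Op, ∀ y, σm x y = 0 := fun x hx y => by
    linarith [hsum x y, hp1 x y (Or.inl (Finset.mem_union_right _ hx))]
  have hp0 : ∀ x ∈ Om, ∀ y, σp x y = 0 := fun x hx y => by
    linarith [hsum x y, hm1 x y (Or.inl hx)]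
  have hpart := sum_restr_transpose_mul_restr hd1 hd2 hd3 hd4 hd5 hd6 hcover
  have hB : restr B * slp B dO σ = 0 := restr_mul_slp_eq_zero
  have hp : restr Op * (lap σp * slp B dO σ) = 0 := by
    have h := restr_mul_lap_mul_slp (d := dO) hd1 hA
    rwa [restr_mul_restr_transpose_of_disjoint hd4, hlap, Matrix.add_mul, Matrix.mul_add,
      ← Matrix.mul_assoc _ (lap σm), restr_mul_lap_eq_zero hm0, Matrix.zero_mul, add_zero] at h
  have hm : restr Om * (lap σm * slp B dO σ) = 0 := by
    have h := restr_mul_lap_mul_slp (d := dO) hd3 hA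
    rwa [restr_mul_restr_transpose_of_disjoint hd6.symm, hlap, Matrix.add_mul, Matrix.mul_add,
      ← Matrix.mul_assoc _ (lap σp), restr_mul_lap_eq_zero hp0, Matrix.zero_mul, zero_add] at h
  have hjump : restr dO * (lap σp * slp B dO σ) + restr dO * (lap σm * slp B dO σ) = 1 := by
    rw [← Matrix.mul_add, ← Matrix.add_mul, ← hlap, restr_mul_lap_mul_slp hd2 hA,
      restr_mul_restr_transpose]
  have hpSchur := restr_mul_eq_schur_mul hOpInv hp
    (lap_mul_eq_of_vanish (d := dO) hpart hB (lap_mul_restr_transpose_eq_zero hσpsymm hp0))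
  have hmSchur := restr_mul_eq_schur_mul hOmInv hm
    (lap_mul_eq_of_vanish (d := dO) (X := Om) (Y := Op) (by rw [← hpart]; abel) hB
      (lap_mul_restr_transpose_eq_zero hσmsymm hm0))
  have hD : Dadj B dO σ σp σm = (1/2 : ℝ) •
      (-(restr dO * (lap σp * slp B dO σ)) + restr dO * (lap σm * slp B dO σ)) := by
    simp only [Dadj, gamma1p, gamma1m, Matrix.add_mul, Matrix.neg_mul, Matrix.mul_assoc]
  change _ = _ * Sop B dO σ at hpSchur hmSchur
  constructor
  · rw [show (-(1/2) : ℝ) • 1 + Dadj B dO σ σp σm = -(restr dO * (lap σp * slp B dO σ)) by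
        rw [hD, ← hjump]; module,
      hpSchur, Matrix.neg_mul, Matrix.mul_nonsing_inv_cancel_right _ _ hS]
  · rw [show ((1/2) : ℝ) • 1 + Dadj B dO σ σp σm = restr dO * (lap σm * slp B dO σ) by
        rw [hD, ← hjump]; module,
      hmSchur, Matrix.mul_nonsing_inv_cancel_right _ _ hS]
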